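/- For every x ∈ ℝ, the function λ ↦ H(x; λ) := ∫_{-∞}^x 2φ(y)Φ(λy) dy is strictly decreasing on ℝ. Consequently, if λ < λ′ then the skew normal distribution SN(λ′) strictly stochastically dominates SN(λ), i.e., H(x; λ′) < H(x; λ) for all x ∈ ℝ. -/

import Mathlib

open MeasureTheory ProbabilityTheory Real Filter
open scoped ENNReal NNReal Topology

noncomputable section

/-- Density of the standard normal distribution. -/
def stdPDF (x : ℝ) : ℝ := Real.exp (-x ^ 2 / 2) / Real.sqrt (2 * Real.pi)

/-- Cumulative distribution function of the standard normal distribution. -/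
def stdCDF (x : ℝ) : ℝ := ∫ y in Set.Iic x, stdPDF y

/-- Density of the skew normal distribution with parameter `l`. -/
def skewPDF (l x : ℝ) : ℝ := 2 * stdPDF x * stdCDF (l * x)

/-- Cumulative distribution function of the skew normal distribution `SN(l)`. -/
def skewCDF (l x : ℝ) : ℝ := ∫ y in Set.Iic x, skewPDF l y

lemma stdPDF_eq_gaussianPDFReal : stdPDF = gaussianPDFReal 0 1 := by
  ext x
  simp [stdPDF, gaussianPDFReal, div_eq_inv_mul]

lemma stdPDF_pos (x : ℝ) : 0 < stdPDF x := by
  unfold stdPDF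
  positivity

lemma stdPDF_neg (x : ℝ) : stdPDF (-x) = stdPDF x := by
  simp [stdPDF]

lemma integrable_stdPDF : Integrable stdPDF := by
  rw [stdPDF_eq_gaussianPDFReal]
  exact integrable_gaussianPDFReal 0 1

lemma strictMono_stdCDF : StrictMono stdCDF := by
  intro a b hab
  have h := intervalIntegral.integral_Iic_sub_Iic (μ := volume) (f := stdPDF) (a := a) (b := b)
    integrable_stdPDF.integrableOn integrable_stdPDF.integrableOn
  have hpos : 0 < ∫ y in a..b, stdPDF y :=
    intervalIntegral.intervalIntegral_pos_of_pos integrable_stdPDF.intervalIntegrable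
      stdPDF_pos hab
  unfold stdCDF
  linarith

lemma stdCDF_neg (t : ℝ) : stdCDF (-t) = (∫ y, stdPDF y) - stdCDF t := by
  have h1 : stdCDF (-t) = ∫ y in Set.Ioi t, stdPDF y := by
    have h := integral_comp_neg_Iic (-t) stdPDF
    simpa only [stdPDF_neg, neg_neg, stdCDF] using h
  have h2 := intervalIntegral.integral_Iic_add_Ioi (μ := volume) (f := stdPDF) (b := t)
    integrable_stdPDF.integrableOn integrable_stdPDF.integrableOn
  rw [h1, ← h2, stdCDF]
  ring

lemma stdCDF_nonneg (t : ℝ) : 0 ≤ stdCDF t :=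
  integral_nonneg fun y => (stdPDF_pos y).le

lemma stdCDF_le (t : ℝ) : stdCDF t ≤ ∫ y, stdPDF y := by
  have h := stdCDF_nonneg (-t)
  rw [stdCDF_neg] at h
  linarith

lemma integrable_skewPDF (l : ℝ) : Integrable (skewPDF l) := by
  refine (integrable_stdPDF.const_mul 2).mul_bdd (c := ∫ y, stdPDF y) ?_ ?_
  · exact (strictMono_stdCDF.monotone.measurable.comp
      (measurable_const_mul l)).aestronglyMeasurable
  · refine ae_of_all _ fun y => ?_
    rw [Real.norm_of_nonneg (stdCDF_nonneg _)]
    exact stdCDF_le _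

lemma skewPDF_sub_neg (l l' y : ℝ) :
    skewPDF l (-y) - skewPDF l' (-y) = -(skewPDF l y - skewPDF l' y) := by
  simp only [skewPDF, stdPDF_neg, mul_neg, stdCDF_neg]
  ring

/-- A function that is positive on the negative half-line and odd has positive
integral over every left half-line. -/
lemma setIntegral_Iic_pos_of_odd {f : ℝ → ℝ} (hf : Integrable f)
    (hodd : ∀ y, f (-y) = -f y) (hpos : ∀ y < 0, 0 < f y) (x : ℝ) :
    0 < ∫ y in Set.Iic x, f y := by
  have hneg : ∀ x ≤ 0, 0 < ∫ y in Set.Iic x, f y := by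
    intro x hx
    rw [integral_Iic_eq_integral_Iio, setIntegral_pos_iff_support_of_nonneg_ae _ hf.integrableOn]
    · have hsub : Set.Iio x ⊆ Function.support f ∩ Set.Iio x := fun y hy =>
        ⟨(hpos y (lt_of_lt_of_le hy hx)).ne', hy⟩
      refine lt_of_lt_of_le ?_ (measure_mono hsub)
      simp
    · exact (ae_restrict_mem measurableSet_Iio).mono fun y hy =>
        (hpos y (lt_of_lt_of_le hy hx)).le
  rcases le_total x 0 with hx | hx
  · exact hneg x hx
  · have htotal : ∫ y, f y = 0 := by
      have h := integral_neg_eq_self f volume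
      simp only [hodd, integral_neg] at h
      linarith
    have hsplit := intervalIntegral.integral_Iic_add_Ioi (μ := volume) (f := f) (b := x)
      hf.integrableOn hf.integrableOn
    have hrefl := integral_comp_neg_Iic (-x) f
    simp only [hodd, integral_neg, neg_neg] at hrefl
    have := hneg (-x) (by linarith)
    linarith

lemma strictAnti_skewCDF (x : ℝ) : StrictAnti fun l : ℝ => skewCDF l x := by
  intro l l' hl
  have h := setIntegral_Iic_pos_of_odd
    ((integrable_skewPDF l).sub (integrable_skewPDF l'))
    (fun y => skewPDF_sub_neg l l' y) (fun y hy => by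
      have hlt : stdCDF (l' * y) < stdCDF (l * y) :=
        strictMono_stdCDF (mul_lt_mul_of_neg_right hl hy)
      have := mul_lt_mul_of_pos_left hlt (mul_pos two_pos (stdPDF_pos y))
      simpa [skewPDF] using this) x
  simp only [Pi.sub_apply] at h
  rw [integral_sub (integrable_skewPDF l).integrableOn (integrable_skewPDF l').integrableOn] at h
  exact sub_pos.mp h

/-- for every `x`, the skew normal CDF `H(x; λ)` is strictly decreasing
in the parameter `λ`; consequently, if `λ < λ'` then `SN(λ')` strictly stochastically
dominates `SN(λ)`. -/
theorem stmt3 :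
    (∀ x : ℝ, StrictAnti fun l : ℝ => skewCDF l x) ∧
    (∀ l l' : ℝ, l < l' → ∀ x : ℝ, skewCDF l' x < skewCDF l x) := by
  exact ⟨strictAnti_skewCDF, fun l l' hl x => strictAnti_skewCDF x hl⟩
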